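/- Polynomiality of the Griffiths polynomials of q-Racah type: for all nonnegative integers i, j with i+j ≤ N, there exists a bivariate polynomial P ∈ ℂ[X,Y] of total degree N−j such that for all nonnegative integers x, y with x+y ≤ N one has G_{i,j}(x,y;c₁,c₂,c₃,c₄;N) = G_{0,N}(x,y;c₁,c₂,c₃,c₄;N)·P(λ(x;c₄c₂), λ(y;c₀c₃)), where G_{0,N}(x,y;c₁,c₂,c₃,c₄;N) = (−1)^N (c₃/c₁)^{N/2}(c₁/c₄)^{y/2}·ξ_N(c₀, c₀c₄q^N)·ξ_y(c₃,c₀), which is nonzero. -/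

import Mathlib

noncomputable section
namespace qR

/-- q-Pochhammer symbol `(a;q)_k = ∏_{l<k} (1 - a qˡ)`. -/
def poch (q a : ℂ) (k : ℕ) : ℂ := ∏ l ∈ Finset.range k, (1 - a * q ^ l)

/-- q-binomial coefficient, zero outside `0 ≤ n ≤ N`. -/
def binom (q : ℂ) (N n : ℤ) : ℂ :=
  if 0 ≤ n ∧ n ≤ N then poch q q N.toNat / (poch q q n.toNat * poch q q (N - n).toNat) else 0

/-- Normalisation `Ω(n;c1,c2,c3;N)`; `s` and `t2` are the chosen square roots of `q` and `c2`,
so that `(q c2)^(n - N/2) = (s t2)^(2n - N)`. -/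
def Om (q s c1 c2 c3 t2 : ℂ) (N n : ℤ) : ℂ :=
  binom q N n * (1 - c2 * c3 * q ^ (2 * n + 1)) * poch q (q * c2) n.toNat
      * poch q (c1 * c2 * c3 * q ^ (N + 2)) n.toNat * poch q (q * c1) (N - n).toNat
    / ((s * t2) ^ (2 * n - N) * poch q (c2 * c3 * q ^ (n + 1)) (N + 1).toNat
        * poch q (q * c3) n.toNat)

/-- Normalised q-Racah polynomial `p_n(x;c1,c2,c3;N)`, with the convention that it
vanishes unless `0 ≤ n ≤ N` and `0 ≤ x ≤ N`. -/
def p (q s c1 c2 c3 t2 : ℂ) (N n x : ℤ) : ℂ :=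
  if 0 ≤ n ∧ n ≤ N ∧ 0 ≤ x ∧ x ≤ N then
    Om q s c1 c2 c3 t2 N n *
      ∑ k ∈ Finset.range (n.toNat + 1),
        poch q (q ^ (-n)) k * poch q (c2 * c3 * q ^ (n + 1)) k * poch q (q ^ (-x)) k
            * poch q (c1 * c2 * q ^ (x + 1)) k * q ^ k
          / (poch q (q * c2) k * poch q (c1 * c2 * c3 * q ^ (N + 2)) k
              * poch q (q ^ (-N)) k * poch q q k)
  else 0

/-- `ω_n(c) = (-1)^n c^{n/2} q^{n(n+1)/2}`, where `r` is the chosen square root of `c`. -/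
def om (q r : ℂ) (n : ℤ) : ℂ := (-1 : ℂ) ^ n * r ^ n * q ^ (n * (n + 1) / 2)

/-- `ξ_n(c1,c2) = ((qc1;q)_n/(qc2;q)_n) (c2/c1)^{n/2}`, where `t1, t2` are the chosen
square roots of `c1, c2`. -/
def xi (q c1 c2 t1 t2 : ℂ) (n : ℤ) : ℂ :=
  poch q (q * c1) n.toNat / poch q (q * c2) n.toNat * (t2 / t1) ^ n

/-- `λ(x;c) = -(1-q^{-x})(1-c q^{x+1})`. -/
def lam (q c : ℂ) (x : ℤ) : ℂ := -(1 - q ^ (-x)) * (1 - c * q ^ (x + 1))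

def PhiP (q c1 c2 c3 : ℂ) (N n : ℤ) : ℂ :=
  -c2 * q ^ (n - N) * (1 - q ^ n) * (1 - c1 * q ^ (N - n + 1)) * (1 - c2 * c3 * q ^ (n + N + 1))
      * (1 - c3 * q ^ n)
    / ((1 - c2 * c3 * q ^ (2 * n)) * (1 - c2 * c3 * q ^ (2 * n + 1)))

def PhiM (q c1 c2 c3 : ℂ) (N n : ℤ) : ℂ :=
  (1 - q ^ (n - N)) * (1 - c1 * c2 * c3 * q ^ (n + N + 2)) * (1 - c2 * q ^ (n + 1))
      * (1 - c2 * c3 * q ^ (n + 1))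
    / ((1 - c2 * c3 * q ^ (2 * n + 1)) * (1 - c2 * c3 * q ^ (2 * n + 2)))

/-- `Φ^ε(n;c1,c2,c3;N)`, where `ε = 1, -1, 0` selects `Φ⁺, Φ⁻, Φ⁰`. -/
def Phi (q c1 c2 c3 : ℂ) (N ε n : ℤ) : ℂ :=
  if ε = 1 then PhiP q c1 c2 c3 N n
  else if ε = -1 then PhiM q c1 c2 c3 N n
  else -PhiP q c1 c2 c3 N n - PhiM q c1 c2 c3 N n

/-- `λ₊(x;c1,c2,c3;N)`. -/
def lamP (q c1 c2 c3 : ℂ) (N x : ℤ) : ℂ :=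
  -(q ^ (-N - 1) / c3 - q ^ (-x)) * (1 - c1 * c2 * c3 * q ^ (N + x + 2))

/-- `λ₋(x;c1,c2,c3;N)`. -/
def lamM (q c1 c2 c3 : ℂ) (N x : ℤ) : ℂ :=
  -(q ^ (-N) - q ^ (-x)) * (1 - c1 * c2 * q ^ (N + x + 1))

def PhiPp (q sq c1 c2 c3 : ℂ) (N n : ℤ) : ℂ :=
  -sq * c2 * q ^ (2 * n - N - 1) * (1 - q ^ n) * (1 - c1 * q ^ (N - n + 1))
      * (1 - c1 * q ^ (N + 2 - n)) * (1 - c3 * q ^ n)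
    / ((1 - c2 * c3 * q ^ (2 * n)) * (1 - c2 * c3 * q ^ (2 * n + 1)))

def PhiPm (q sq c1 c2 c3 : ℂ) (N n : ℤ) : ℂ :=
  -((1 - c1 * c2 * c3 * q ^ (n + N + 2)) * (1 - c1 * c2 * c3 * q ^ (n + N + 3))
      * (1 - c2 * q ^ (n + 1)) * (1 - c2 * c3 * q ^ (n + 1)))
    / (c3 * q ^ (N + 1) * sq * (1 - c2 * c3 * q ^ (2 * n + 1)) * (1 - c2 * c3 * q ^ (2 * n + 2)))

def PhiP0 (q sq c1 c2 c3 : ℂ) (N n : ℤ) : ℂ :=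
  -PhiPp q sq c1 c2 c3 N n - PhiPm q sq c1 c2 c3 N n
    - (1 - c1 * c2 * q ^ (N + 2)) * (1 - c1 * c2 * c3 * q ^ (N + 2)) / (c3 * q ^ (N + 1) * sq)

def PhiMp (q sq c1 c2 c3 : ℂ) (N n : ℤ) : ℂ :=
  -sq * (1 - q ^ n) * (1 - c3 * q ^ n) * (1 - c2 * c3 * q ^ (n + N))
      * (1 - c2 * c3 * q ^ (n + N + 1))
    / (q ^ N * (1 - c2 * c3 * q ^ (2 * n)) * (1 - c2 * c3 * q ^ (2 * n + 1)))

def PhiMm (q sq c1 c2 c3 : ℂ) (N n : ℤ) : ℂ :=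
  -c3 * sq * q ^ N * (1 - q ^ (n - N)) * (1 - q ^ (n - N + 1)) * (1 - c2 * q ^ (n + 1))
      * (1 - c2 * c3 * q ^ (n + 1))
    / ((1 - c2 * c3 * q ^ (2 * n + 1)) * (1 - c2 * c3 * q ^ (2 * n + 2)))

def PhiM0 (q sq c1 c2 c3 : ℂ) (N n : ℤ) : ℂ :=
  -PhiMp q sq c1 c2 c3 N n - PhiMm q sq c1 c2 c3 N n - sq * (1 - c3 * q ^ N) * (q ^ (-N) - 1)

/-- Contiguity coefficient `Φ_σ^ε(n;c1,c2,c3;N)`, where `σ = 1` is the `+` and `σ = -1`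
the `-` family, `ε ∈ {1,0,-1}` selects the superscript, and `sq` is the chosen square
root of `q c2`. -/
def PhiC (q sq c1 c2 c3 : ℂ) (σ ε N n : ℤ) : ℂ :=
  if σ = 1 then
    if ε = 1 then PhiPp q sq c1 c2 c3 N n
    else if ε = -1 then PhiPm q sq c1 c2 c3 N n
    else PhiP0 q sq c1 c2 c3 N n
  else
    if ε = 1 then PhiMp q sq c1 c2 c3 N n
    else if ε = -1 then PhiMm q sq c1 c2 c3 N n
    else PhiM0 q sq c1 c2 c3 N n

def Fp (q c1 c2 : ℂ) (x : ℤ) : ℂ :=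
  c1 * c2 ^ 2 * q ^ (x + 1) * (1 - c1 * q ^ x) * (1 - q ^ x)
    / ((1 - c1 * c2 * q ^ (2 * x)) * (1 - c1 * c2 * q ^ (2 * x + 1)))

def Fm (q c1 c2 : ℂ) (x : ℤ) : ℂ :=
  c1 * c2 * q ^ (x + 1) * (1 - c2 * q ^ (x + 1)) * (1 - c1 * c2 * q ^ (x + 1))
    / ((1 - c1 * c2 * q ^ (2 * x + 1)) * (1 - c1 * c2 * q ^ (2 * x + 2)))

/-- The coefficients `A^{ε,ε'}_{i,j}(c1,c2,c3,c4;N)` for `(ε,ε') ≠ (0,0)`;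
`t2` is the chosen square root of `c2` and the fifth parameter
`c0 = (q^{2N+3} c1 c2 c3 c4)⁻¹` is computed internally. -/
def Aaux (q s c1 c2 c3 c4 t2 : ℂ) (N ε ε' i j : ℤ) : ℂ :=
  if ε' = 1 ∨ ε' = -1 then
    -c3 * q ^ (N + 1) *
        (if ε' = 1 then Fp q c4 ((q ^ (2 * N + 3) * c1 * c2 * c3 * c4)⁻¹) j
         else Fm q c4 ((q ^ (2 * N + 3) * c1 * c2 * c3 * c4)⁻¹) j) *
        PhiC q (s * t2) c1 c2 c3 ε' ε (N - j) i
  else if ε = 1 ∨ ε = -1 then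
    c3 * q ^ (N + 1) *
        (Fp q c4 ((q ^ (2 * N + 3) * c1 * c2 * c3 * c4)⁻¹) j
          + Fm q c4 ((q ^ (2 * N + 3) * c1 * c2 * c3 * c4)⁻¹) j) *
        Phi q c1 c2 c3 (N - j) ε i
  else 0

/-- The coefficients `A^{ε,ε'}_{i,j}(c1,c2,c3,c4;N)`. -/
def A (q s c1 c2 c3 c4 t2 : ℂ) (N ε ε' i j : ℤ) : ℂ :=
  if ε = 0 ∧ ε' = 0 then
    -((1 - c3 * q ^ (N + 1 - j)) * (s * t2) / (1 - c1 * c2 * q ^ (N + 2 - j)))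
          * ∑ e ∈ ({-1, 0, 1} : Finset ℤ), Aaux q s c1 c2 c3 c4 t2 N e 1 i j
      - (1 - c1 * c2 * q ^ (N + 1 - j)) / ((1 - c3 * q ^ (N - j)) * (s * t2))
          * ∑ e ∈ ({-1, 0, 1} : Finset ℤ), Aaux q s c1 c2 c3 c4 t2 N e (-1) i j
      - ∑ e ∈ ({-1, 1} : Finset ℤ), Aaux q s c1 c2 c3 c4 t2 N e 0 i j
  else Aaux q s c1 c2 c3 c4 t2 N ε ε' i j

/-- `Λ(x;c1,c2,c3,c4;N)`; `s, t1, t2, t3, t4` are the chosen square roots of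
`q, c1, c2, c3, c4`. -/
def Lam (q s c1 c2 c3 c4 t1 t2 t3 t4 : ℂ) (N x : ℤ) : ℂ :=
  (-1 : ℂ) ^ x * binom q N x * (1 - c1 * c2 * q ^ (2 * x + 1)) * poch q (q * c2) x.toNat
      * (s * t2) ^ N * (t1 * t3 / (t2 * t4)) ^ x * q ^ (x * (x - 1) / 2)
    / (poch q (q * c1) x.toNat * poch q (q ^ (x + 1) * c1 * c2) (N + 1).toNat)

/-- Tratnik polynomial of q-Racah type `T_{i,j}(x,y;c1,c2,c3,c4;N)`; the fifth parameter
`c0 = (q^{2N+3} c1 c2 c3 c4)⁻¹` and its square root `t0 = (s^{2N+3} t1 t2 t3 t4)⁻¹`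
are computed internally. -/
def T (q s c1 c2 c3 c4 t1 t2 t3 t4 : ℂ) (N i j x y : ℤ) : ℂ :=
  if 0 ≤ i ∧ 0 ≤ j ∧ i + j ≤ N then
    p q s c1 c2 c3 t2 (N - j) i x *
      p q s c3 ((q ^ (2 * N + 3) * c1 * c2 * c3 * c4)⁻¹) c4
        ((s ^ (2 * N + 3) * t1 * t2 * t3 * t4)⁻¹) (N - x) j y
  else 0

/-- Griffiths polynomial of q-Racah type `G_{i,j}(x,y;c1,c2,c3,c4;N)`; the fifth parameter
`c0 = (q^{2N+3} c1 c2 c3 c4)⁻¹` and its square root `t0 = (s^{2N+3} t1 t2 t3 t4)⁻¹`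
are computed internally. -/
def G (q s c1 c2 c3 c4 t1 t2 t3 t4 : ℂ) (N i j x y : ℤ) : ℂ :=
  if 0 ≤ i ∧ 0 ≤ j ∧ i + j ≤ N then
    ∑ a ∈ Finset.range ((min (N - j) (N - y)).toNat + 1),
      om q (t1 * t2 * t3 / t4) (a : ℤ) * p q s c1 c2 c3 t2 (N - j) i (a : ℤ) *
        p q s c3 ((q ^ (2 * N + 3) * c1 * c2 * c3 * c4)⁻¹) c4
          ((s ^ (2 * N + 3) * t1 * t2 * t3 * t4)⁻¹) (N - (a : ℤ)) j y *
        p q s c4 c2 c1 t2 (N - y) (a : ℤ) x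
  else 0

end qR

namespace qR

lemma poch_zero (q a : ℂ) : poch q a 0 = 1 := by simp [poch]
lemma poch_succ (q a : ℂ) (k : ℕ) : poch q a (k+1) = poch q a k * (1 - a * q^k) := by
  simp [poch, Finset.prod_range_succ]
lemma poch_succ' (q a : ℂ) (k : ℕ) : poch q a (k+1) = (1 - a) * poch q (a*q) k := by
  simp only [poch, Finset.prod_range_succ']
  rw [mul_comm]; simp only [pow_zero, mul_one]
  congr 1
  exact Finset.prod_congr rfl fun l _ => by ring
lemma poch_add (q a : ℂ) (m n : ℕ) : poch q a (m+n) = poch q a m * poch q (a*q^m) n := by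
  simp only [poch, Finset.prod_range_add]
  congr 1
  exact Finset.prod_congr rfl fun l _ => by ring

lemma poch_ne {q a : ℂ} {k : ℕ} (h : ∀ l < k, a * q^l ≠ 1) : poch q a k ≠ 0 := by
  rw [poch, Finset.prod_ne_zero_iff]
  intro l hl
  have := h l (Finset.mem_range.1 hl)
  exact fun h => this (sub_eq_zero.1 h).symm

lemma poch_ne_of_le {q a : ℂ} {k n : ℕ} (hk : k ≤ n) (h : poch q a n ≠ 0) : poch q a k ≠ 0 := by
  obtain ⟨r, rfl⟩ := Nat.exists_eq_add_of_le hk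
  rw [poch_add] at h
  exact left_ne_zero_of_mul h

lemma poch_rev (q e e' : ℂ) (n : ℕ) (h : e * e' * q^n = q) (hq : q ≠ 0) :
    poch q e n = (∏ l ∈ Finset.range n, (-(e * q^l))) * poch q e' n := by
  unfold poch
  rw [← Finset.prod_range_reflect (fun l => 1 - e' * q^l), ← Finset.prod_mul_distrib]
  refine Finset.prod_congr rfl fun l hl => ?_
  have hl := Finset.mem_range.1 hl
  obtain ⟨r, rfl⟩ : ∃ r, n = l + r + 1 := ⟨n - l - 1, by omega⟩
  have : l + r + 1 - 1 - l = r := by omega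
  rw [this]
  have h2 : e * e' * q^(l+r) = 1 := by
    apply mul_right_cancel₀ hq
    linear_combination h
  linear_combination -h2

noncomputable def saalT (q a b d : ℂ) (n k : ℕ) : ℂ :=
  poch q q n / (poch q q k * poch q q (n-k)) * poch q a k * poch q b k * poch q d (n-k) * d^k
    * poch q (a*b*d*q^k) (n-k)

lemma saal_partial (q a b d : ℂ) (n : ℕ) (hq : poch q q (n+1) ≠ 0) (K : ℕ) (hK : K ≤ n) :
    ∑ k ∈ Finset.range (K+1), (saalT q a b d (n+1) k - (1-b*d*q^n)*(1-a*d*q^n) * saalT q a b d n k)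
      = - d * q^(n-K) * (1-a*q^K) * (1-b*q^K) * saalT q a b d n K := by
  induction K with
  | zero =>
    have h0 : poch q q n ≠ 0 := poch_ne_of_le (by omega) hq
    simp [saalT, poch_zero]
    rw [div_self hq, div_self h0, poch_succ, poch_succ]
    ring
  | succ K ih =>
    rw [Finset.sum_range_succ, ih (by omega)]
    obtain ⟨r, rfl⟩ := Nat.exists_eq_add_of_le hK
    have e1 : K + 1 + r - K = r + 1 := by omega
    have e2 : K + 1 + r - (K+1) = r := by omega
    have e3 : K + 1 + r + 1 - (K+1) = r + 1 := by omega
    have e4 : K + 1 + r + 1 = (K + r + 1) + 1 := by omega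
    have e5 : K + 1 + r = (K + r) + 1 := by omega
    have h1 : poch q q (K+1) ≠ 0 := poch_ne_of_le (by omega) hq
    have h2 : poch q q (r+1) ≠ 0 := poch_ne_of_le (by omega) hq
    unfold saalT
    rw [e1, e2, e3]
    have e6 : poch q (a*b*d*q^K) (r+1) = (1 - a*b*d*q^K) * poch q (a*b*d*q^(K+1)) r := by
      rw [poch_succ']; ring_nf
    rw [e6]
    rw [poch_succ] at h1 h2
    rw [poch_succ q q (K+1+r), poch_succ q q K, poch_succ q q r, poch_succ q a K, poch_succ q b K,
      poch_succ q d r, poch_succ q _ r]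
    have g1 := left_ne_zero_of_mul h1
    have g2 := right_ne_zero_of_mul h1
    have g3 := left_ne_zero_of_mul h2
    have g4 := right_ne_zero_of_mul h2
    have p1 : q^(K+1) = q^K * q := by ring
    have p2 : q^(K+1+r) = q^K * q * q^r := by ring
    have p3 : q^(r+1) = q^r * q := by ring
    generalize poch q (a*b*d*q^(K+1)) r = Z
    rw [p1, p2, p3]
    generalize q^K = z at *
    generalize q^r = w at *
    generalize poch q q (K+1+r) = Y
    generalize poch q q K = Y1 at *
    generalize poch q q r = Y2 at *
    have g2' : 1 - z * q ≠ 0 := by rwa [mul_comm]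
    have g4' : 1 - w * q ≠ 0 := by rwa [mul_comm]
    clear ih e6 p1 p2 p3 h1 h2 hq
    field_simp
    ring

lemma saal (q a b d : ℂ) (n : ℕ) (hq : poch q q n ≠ 0) :
    ∑ k ∈ Finset.range (n+1), saalT q a b d n k = poch q (b*d) n * poch q (a*d) n := by
  induction n with
  | zero => simp [saalT, poch_zero]
  | succ n ih =>
    have h0 : poch q q n ≠ 0 := poch_ne_of_le (by omega) hq
    have := saal_partial q a b d n hq n le_rfl
    rw [Finset.sum_sub_distrib, ← Finset.mul_sum, ih h0] at this
    rw [Finset.sum_range_succ, sub_eq_iff_eq_add.1 this, poch_succ, poch_succ]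
    simp only [saalT, Nat.sub_self, poch_zero, poch_succ q a, poch_succ q b]
    rw [mul_one (poch q q n), mul_one (poch q q (n+1)), div_self hq, div_self h0]
    ring

/-- conversion -/
lemma poch_conv (q d Q F : ℂ) (n r : ℕ) (hr : r ≤ n) (hQ : Q * q^n = 1) (hF : F * d * q^n = q) (hq : q ≠ 0) :
    poch q Q r * q^r * poch q d n * poch q q (n-r) = d^r * poch q q n * poch q d (n-r) * poch q F r := by
  induction r with
  | zero => simp [poch_zero]; ring
  | succ r ih =>
    have ih := ih (by omega)
    obtain ⟨m, rfl⟩ := Nat.exists_eq_add_of_le hr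
    have e1 : r + 1 + m - r = m + 1 := by omega
    have e2 : r + 1 + m - (r+1) = m := by omega
    rw [e1] at ih
    rw [e2, poch_succ, poch_succ q F]
    rw [poch_succ q q m, poch_succ q d m] at ih
    have k1 : (1 - Q * q^r) * q^(m+1) = - (1 - q * q^m) := by
      linear_combination - hQ
    have k2 : (1 - F * q^r) * d * q^m = - (1 - d * q^m) := by
      apply mul_right_cancel₀ hq
      linear_combination - hF
    have hqm : q^(m+1) ≠ 0 := pow_ne_zero _ hq
    apply mul_right_cancel₀ hqm
    linear_combination (q^(r+1) * poch q Q r * poch q d (r+1+m) * poch q q m) * k1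
      - (d^r * poch q q (r+1+m) * poch q d m * poch q F r * q) * k2 - q * ih
end qR

namespace qR

lemma poch_rev_ne {q e e' : ℂ} {n : ℕ} (h : e * e' * q^n = q) (hq : q ≠ 0) (h0 : poch q e n ≠ 0) :
    poch q e' n ≠ 0 := by
  rw [poch_rev q e e' n h hq] at h0
  exact right_ne_zero_of_mul h0

lemma saal3 (q a b d Q F : ℂ) (n : ℕ) (hQ : Q * q^n = 1) (hF : F * d * q^n = q) (hq : q ≠ 0)
    (h1 : poch q q n ≠ 0) (h2 : poch q d n ≠ 0) (h3 : poch q (a*b*d) n ≠ 0) :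
    ∑ r ∈ Finset.range (n+1), poch q Q r * poch q a r * poch q b r * q^r /
      (poch q (a*b*d) r * poch q F r * poch q q r)
      = poch q (b*d) n * poch q (a*d) n / (poch q (a*b*d) n * poch q d n) := by
  rw [← saal q a b d n h1, Finset.sum_div]
  refine Finset.sum_congr rfl fun r hr => ?_
  have hr : r ≤ n := Nat.lt_succ_iff.1 (Finset.mem_range.1 hr)
  have hFn : poch q F n ≠ 0 := poch_rev_ne (by linear_combination hF) hq h2
  have c := poch_conv q d Q F n r hr hQ hF hq
  have k1 : poch q q r ≠ 0 := poch_ne_of_le hr h1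
  have k2 : poch q q (n-r) ≠ 0 := poch_ne_of_le (by omega) h1
  have k3 : poch q F r ≠ 0 := poch_ne_of_le hr hFn
  have e : poch q (a*b*d) n = poch q (a*b*d) r * poch q (a*b*d*q^r) (n-r) := by
    rw [← poch_add]; congr 1; omega
  rw [e] at h3
  have k4 := left_ne_zero_of_mul h3
  have k5 := right_ne_zero_of_mul h3
  rw [saalT, e]
  rw [div_eq_div_iff (by positivity) (by positivity)]
  generalize poch q (a*b*d*q^r) (n-r) = Z at *
  field_simp
  linear_combination (poch q a r * poch q b r) * c

lemma sears (q A u v g E F Q : ℂ) (y : ℕ) (hQ : Q * q^y = 1) (hF : F * E = q * A * g * Q) (hq : q ≠ 0)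
    (hA : A ≠ 0) (hg : g ≠ 0) (hE : E ≠ 0)
    (h1 : poch q q y ≠ 0) (h2 : poch q F y ≠ 0) (h3 : poch q E y ≠ 0) (h4 : poch q (u*v*g) y ≠ 0) :
    ∑ k ∈ Finset.range (y+1), poch q Q k * poch q A k * poch q (v*g) k * poch q (u*g) k * q^k /
      (poch q (u*v*g) k * poch q E k * poch q F k * poch q q k)
    = ∑ m ∈ Finset.range (y+1), poch q u m * poch q v m * (g * q)^m * poch q Q m * poch q A m /
      (poch q (u*v*g) m * poch q q m) * (poch q (E/A) (y-m) * poch q (E*q^m/g) (y-m)) /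
      (poch q F m * poch q E y * poch q (E/(A*g)) (y-m)) := by
  let f : ℕ → ℕ → ℂ := fun m r => poch q Q (m+r) * poch q A (m+r) * q^(m+r) /
    (poch q E (m+r) * poch q F (m+r)) * (poch q u m * poch q v m * poch q g r * g^m) /
      (poch q (u*v*g) m * poch q q m * poch q q r)
  have L : ∀ k ∈ Finset.range (y+1), poch q Q k * poch q A k * poch q (v*g) k * poch q (u*g) k * q^k /
      (poch q (u*v*g) k * poch q E k * poch q F k * poch q q k) =
      ∑ m ∈ Finset.range (k+1), f m (k-m) := by
    intro k hk
    have hk : k ≤ y := Nat.lt_succ_iff.1 (Finset.mem_range.1 hk)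
    have := saal q u v g k (poch_ne_of_le hk h1)
    have e0 : poch q Q k * poch q A k * poch q (v*g) k * poch q (u*g) k * q^k /
      (poch q (u*v*g) k * poch q E k * poch q F k * poch q q k) = 
      poch q Q k * poch q A k * q^k /
      (poch q (u*v*g) k * poch q E k * poch q F k * poch q q k) * (poch q (v*g) k * poch q (u*g) k) := by
      ring
    rw [e0, ← this, Finset.mul_sum]
    refine Finset.sum_congr rfl fun m hm => ?_
    have hm : m ≤ k := Nat.lt_succ_iff.1 (Finset.mem_range.1 hm)
    have e : poch q (u*v*g) k = poch q (u*v*g) m * poch q (u*v*g*q^m) (k-m) := by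
      rw [← poch_add]; congr 1; omega
    have h4k := poch_ne_of_le hk h4
    have h1k := poch_ne_of_le hk h1
    rw [e] at h4k
    have k4 := left_ne_zero_of_mul h4k
    have k5 := right_ne_zero_of_mul h4k
    have e2 : m + (k - m) = k := by omega
    simp only [f, saalT, e2]
    rw [e]
    field_simp
  rw [Finset.sum_congr rfl L, Finset.sum_range_diag_flip]
  refine Finset.sum_congr rfl fun m hm => ?_
  have hm : m ≤ y := Nat.lt_succ_iff.1 (Finset.mem_range.1 hm)
  have e1 : y + 1 - m = (y - m) + 1 := by omega
  rw [e1]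
  obtain ⟨n, rfl⟩ := Nat.exists_eq_add_of_le hm
  have e2 : m + n - m = n := by omega
  rw [e2]
  rw [poch_add] at h2 h3
  have hd : (F * q^m) * (E/(A*g)) * q^n = q := by
    field_simp
    have : A * g * q = A * g * q * (Q * q^(m+n)) := by rw [hQ]; ring
    rw [this, pow_add]
    linear_combination q^m * q^n * hF
  have hdn : poch q (E/(A*g)) n ≠ 0 := poch_rev_ne hd hq (right_ne_zero_of_mul h2)
  have hab : (A * q^m) * g * (E/(A*g)) = E * q^m := by field_simp
  have S := saal3 q (A*q^m) g (E/(A*g)) (Q*q^m) (F*q^m) n (by rw [← hQ]; ring) hd hq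
    (poch_ne_of_le (by omega) h1) hdn (by rw [hab]; exact right_ne_zero_of_mul h3)
  rw [hab] at S
  have b1 : g * (E/(A*g)) = E/A := by field_simp
  have b2 : A * q^m * (E/(A*g)) = E*q^m/g := by field_simp
  rw [b1, b2] at S
  have T : ∑ r ∈ Finset.range (n+1), f m r = 
     poch q u m * poch q v m * (g * q)^m * poch q Q m * poch q A m /
      (poch q (u*v*g) m * poch q q m * (poch q F m * poch q E m)) * 
      ∑ r ∈ Finset.range (n+1), poch q (Q*q^m) r * poch q (A*q^m) r * poch q g r * q^r /
      (poch q (E*q^m) r * poch q (F*q^m) r * poch q q r) := by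
    rw [Finset.mul_sum]
    refine Finset.sum_congr rfl fun r hr => ?_
    simp only [f, poch_add]
    rw [mul_pow, pow_add]
    simp only [div_eq_mul_inv, mul_inv]
    ring
  rw [T, S, poch_add q E]
  simp only [div_eq_mul_inv, mul_inv]
  ring
end qR

namespace qR

lemma rev_ratio (q e e' h h' g : ℂ) (n : ℕ) (he : e * e' * q^n = q) (hh : h * h' * q^n = q) (hq : q ≠ 0)
    (hg : e = g * h) : poch q e n * poch q h' n = g^n * poch q h n * poch q e' n := by
  rw [poch_rev q e e' n he hq, poch_rev q h h' n hh hq]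
  have : (∏ l ∈ Finset.range n, (-(e * q^l))) = g^n * ∏ l ∈ Finset.range n, (-(h * q^l)) := by
    rw [← Finset.card_range n, ← Finset.prod_const, Finset.card_range, ← Finset.prod_mul_distrib]
    exact Finset.prod_congr rfl fun l _ => by rw [hg]; ring
  rw [this]; ring

lemma poch_inv_zero (q : ℂ) (hq : q ≠ 0) (n k : ℕ) (h : n < k) : poch q ((q^n)⁻¹) k = 0 := by
  rw [poch, Finset.prod_eq_zero_iff]
  exact ⟨n, Finset.mem_range.2 h, by rw [inv_mul_cancel₀ (pow_ne_zero _ hq), sub_self]⟩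

lemma sum_trunc (f : ℕ → ℂ) (n m : ℕ) (h1 : ∀ k, n < k → f k = 0) (h2 : ∀ k, m < k → f k = 0) :
    ∑ k ∈ Finset.range (n+1), f k = ∑ k ∈ Finset.range (m+1), f k := by
  have key : ∀ n K, n ≤ K → (∀ k, n < k → f k = 0) →
      ∑ k ∈ Finset.range (n+1), f k = ∑ k ∈ Finset.range (K+1), f k := by
    intro n K hK h
    refine Finset.sum_subset (Finset.range_subset_range.2 (by omega)) fun k _ hk => h k ?_
    simp at hk; omega
  rw [key n (n+m) (by omega) h1, key m (n+m) (by omega) h2]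

noncomputable def Wsum (q c0 c3 c4 : ℂ) (M j y : ℕ) : ℂ :=
  ∑ m ∈ Finset.range (M-j+1), poch q ((q^(M-j))⁻¹) m * poch q ((c0*c4*q^(M+j+1))⁻¹) m * q^m /
    (poch q ((q^M)⁻¹) m * poch q q m * poch q (q*c3) m * poch q ((c4*q^M)⁻¹) m) *
    (poch q ((q^y)⁻¹) m * poch q (c0*c3*q^(y+1)) m)

lemma ysum (q c0 c3 c4 : ℂ) (M j y : ℕ) (hj : j ≤ M) (hq : q ≠ 0)
    (hc0 : c0 ≠ 0) (hc3 : c3 ≠ 0) (hc4 : c4 ≠ 0)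
    (h1 : poch q q y ≠ 0) (h2 : poch q (c3*c0*c4*q^(M+2)) y ≠ 0) (h3 : poch q (q*c0) y ≠ 0)
    (h4 : poch q ((q^M)⁻¹) y ≠ 0) (h5 : poch q (q*c3) y ≠ 0) (h6 : poch q ((c4*q^M)⁻¹) y ≠ 0) :
    ∑ k ∈ Finset.range (j+1), poch q ((q^j)⁻¹) k * poch q (c0*c4*q^(j+1)) k * poch q ((q^y)⁻¹) k
        * poch q (c3*c0*q^(y+1)) k * q^k /
      (poch q (q*c0) k * poch q (c3*c0*c4*q^(M+2)) k * poch q ((q^M)⁻¹) k * poch q q k)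
    = (c0*c4*q^(M+1))^y * poch q (q*c3) y * poch q ((c4*q^M)⁻¹) y /
      (poch q (q*c0) y * poch q (c3*c0*c4*q^(M+2)) y) * Wsum q c0 c3 c4 M j y := by
  have hM : q^(M-j) * q^j = q^M := by rw [← pow_add]; congr 1; omega
  have n1 : q^(M-j) ≠ 0 := pow_ne_zero _ hq
  have n2 : q^j ≠ 0 := pow_ne_zero _ hq
  have n3 : q^y ≠ 0 := pow_ne_zero _ hq
  have n4 : q^M ≠ 0 := pow_ne_zero _ hq
  have vg : (c0*c4*q^(M+j+1))⁻¹ * (c0*c4*q^(M+1)) = (q^j)⁻¹ := by field_simp; ring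
  have ug : (q^(M-j))⁻¹ * (c0*c4*q^(M+1)) = c0*c4*q^(j+1) := by
    field_simp; rw [pow_succ, ← hM, pow_succ]; ring
  have uvg : (q^(M-j))⁻¹ * (c0*c4*q^(M+j+1))⁻¹ * (c0*c4*q^(M+1)) = (q^M)⁻¹ := by
    rw [mul_assoc, vg, ← hM, mul_inv]
  have S := sears q (c0*c3*q^(y+1)) ((q^(M-j))⁻¹) ((c0*c4*q^(M+j+1))⁻¹) (c0*c4*q^(M+1)) (q*c0)
    (c3*c0*c4*q^(M+2)) ((q^y)⁻¹) y (inv_mul_cancel₀ n3) (by field_simp; ring) hq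
    (by positivity) (by positivity) (by positivity) h1 h2 h3 (by rw [uvg]; exact h4)
  rw [vg, ug, uvg] at S
  rw [sum_trunc _ j y (fun k hk => by rw [poch_inv_zero q hq j k hk]; simp)
    (fun k hk => by rw [poch_inv_zero q hq y k hk]; simp)]
  rw [Wsum, sum_trunc _ (M-j) y (fun k hk => by rw [poch_inv_zero q hq (M-j) k hk]; simp)
    (fun k hk => by rw [poch_inv_zero q hq y k hk]; simp), Finset.mul_sum]
  trans
  swap
  · refine S.trans (Finset.sum_congr rfl fun m hm => ?_)
    have hm : m ≤ y := Nat.lt_succ_iff.1 (Finset.mem_range.1 hm)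
    obtain ⟨n, rfl⟩ := Nat.exists_eq_add_of_le hm
    have e2 : m + n - m = n := by omega
    have R := rev_ratio q (q*c0/(c0*c3*q^(m+n+1))) (q*c3*q^m) (q*c0/(c0*c3*q^(m+n+1)*(c0*c4*q^(M+1))))
      (c3*c0*c4*q^(M+2)*q^m) (c0*c4*q^(M+1)) n (by field_simp; ring) (by field_simp; ring) hq
      (by field_simp)
    have e3 : q*c0*q^m/(c0*c4*q^(M+1)) = (c4*q^M)⁻¹ * q^m := by field_simp; ring
    rw [e2, e3]
    have hR : poch q (q*c0/(c0*c3*q^(m+n+1)*(c0*c4*q^(M+1)))) n ≠ 0 := by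
      rw [poch_add] at h2
      exact poch_rev_ne (e := c3*c0*c4*q^(M+2)*q^m) (by field_simp; ring) hq (right_ne_zero_of_mul h2)
    rw [poch_add q (q*c3)] at h5 ⊢
    rw [poch_add q (c3*c0*c4*q^(M+2))] at h2 ⊢
    rw [poch_add q (q*c0)] at h3 ⊢
    rw [poch_add q ((c4*q^M)⁻¹)] at h6 ⊢
    rw [poch_add q ((q^M)⁻¹)] at h4
    rw [poch_add q q] at h1
    have a1 := left_ne_zero_of_mul h1
    have a2 := left_ne_zero_of_mul h2
    have a3 := left_ne_zero_of_mul h3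
    have a4 := left_ne_zero_of_mul h4
    have a5 := left_ne_zero_of_mul h5
    have a6 := left_ne_zero_of_mul h6
    have b2 := right_ne_zero_of_mul h2
    have b3 := right_ne_zero_of_mul h3
    rw [mul_pow (c0*c4*q^(M+1)) q m, pow_add (c0*c4*q^(M+1)) m n]
    clear S uvg vg ug e3 h1 h2 h3 h4 h5 h6
    generalize poch q (q*c0/(c0*c3*q^(m+n+1))) n = X1 at *
    generalize poch q (q*c0/(c0*c3*q^(m+n+1)*(c0*c4*q^(M+1)))) n = X2 at *
    generalize poch q (c3*c0*c4*q^(M+2)*q^m) n = X3 at *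
    generalize poch q (q*c3*q^m) n = X4 at *
    generalize (c0*c4*q^(M+1)) = g at *
    generalize poch q (c3*c0*c4*q^(M+2)) m = X5 at *
    generalize poch q ((c4*q^M)⁻¹ * q^m) n = X6 at *
    generalize poch q ((c4*q^M)⁻¹) m = X7 at *
    generalize poch q (q*c0*q^m) n = X8 at *
    generalize poch q (q*c0) m = X9 at *
    generalize poch q (q*c3) m = X10 at *
    generalize poch q q m = X11 at *
    generalize poch q ((q^M)⁻¹) m = X12 at *
    generalize poch q ((q^(m+n))⁻¹) m = X13 at *
    generalize poch q (c0*c3*q^(m+n+1)) m = X14 at *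
    generalize poch q ((q^(M-j))⁻¹) m = X15 at *
    generalize poch q ((c0*c4*q^(M+j+1))⁻¹) m = X16 at *
    field_simp
    linear_combination g^m * X16 * X15 * X14 * X13 * X6 * R
  · exact Finset.sum_congr rfl fun k _ => by rw [mul_comm c3 c0]; ring
end qR

namespace qR

noncomputable def OmN (q s c1 c2 c3 t2 : ℂ) (n r : ℕ) : ℂ :=
  poch q q (n+r)/(poch q q n*poch q q r)*(1-c2*c3*q^(2*n+1))*poch q (q*c2) n
    *poch q (c1*c2*c3*q^(n+r+2)) n*poch q (q*c1) r*(s*t2)^(n+r)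
    /((s*t2)^(2*n)*poch q (c2*c3*q^(n+1)) (n+r+1)*poch q (q*c3) n)

noncomputable def SumN (q c1 c2 c3 : ℂ) (N n x : ℕ) : ℂ :=
  ∑ k ∈ Finset.range (n + 1),
        poch q ((q^n)⁻¹) k * poch q (c2 * c3 * q ^ (n + 1)) k * poch q ((q ^ x)⁻¹) k
            * poch q (c1 * c2 * q ^ (x + 1)) k * q ^ k
          / (poch q (q * c2) k * poch q (c1 * c2 * c3 * q ^ (N + 2)) k
              * poch q ((q ^ N)⁻¹) k * poch q q k)

lemma p_nat (q s c1 c2 c3 t2 : ℂ) (hst : s * t2 ≠ 0) (n r x : ℕ) (hx : x ≤ n + r) :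
    p q s c1 c2 c3 t2 ((n + r : ℕ) : ℤ) (n : ℤ) (x : ℤ) =
      OmN q s c1 c2 c3 t2 n r * SumN q c1 c2 c3 (n+r) n x := by
  have c1' : (0:ℤ) ≤ n ∧ (n:ℤ) ≤ ((n+r:ℕ):ℤ) ∧ (0:ℤ) ≤ x ∧ (x:ℤ) ≤ ((n+r:ℕ):ℤ) := by omega
  have c2' : (0:ℤ) ≤ n ∧ (n:ℤ) ≤ ((n+r:ℕ):ℤ) := by omega
  have z : ∀ (w : ℂ) (k : ℕ), w ^ (k:ℤ) = w^k := fun w k => zpow_natCast w k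
  rw [p, if_pos c1']
  have e1 : (2 * (n:ℤ) + 1) = ((2*n+1 : ℕ) : ℤ) := by push_cast; ring
  have e2 : (((n+r:ℕ):ℤ) + 2) = ((n+r+2 : ℕ) : ℤ) := by push_cast; ring
  have e3 : (((n+r:ℕ):ℤ) - n).toNat = r := by omega
  have e4 : ((n:ℤ) + 1) = ((n+1:ℕ):ℤ) := by push_cast; ring
  have e5 : (((n+r:ℕ):ℤ) + 1).toNat = n+r+1 := by omega
  have e6 : (s*t2)^(2*(n:ℤ) - ((n+r:ℕ):ℤ)) = (s*t2)^(2*n) / (s*t2)^(n+r) := by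
    rw [zpow_sub₀ hst, z, ← z _ (2*n)]; push_cast; rfl
  have e7 : ((x:ℤ) + 1) = ((x+1:ℕ):ℤ) := by push_cast; ring
  congr 1
  · rw [Om, binom, if_pos c2', e1, e2, e3, e4, e5, e6, z, z, z, Int.toNat_natCast, Int.toNat_natCast, OmN]
    simp only [div_eq_mul_inv, mul_inv, inv_inv]
    ring
  · rw [SumN, Int.toNat_natCast, zpow_neg, zpow_neg, zpow_neg, e2, e4, e7]
    simp only [z]

lemma poch_inv_ne {q : ℂ} (hq : q ≠ 0) {n k : ℕ} (hk : k ≤ n) (h : poch q q n ≠ 0) :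
    poch q ((q^n)⁻¹) k ≠ 0 := 
  poch_ne_of_le hk (poch_rev_ne (e := q) (by field_simp) hq h)

noncomputable def Psi (q w : ℂ) (N a k y : ℕ) : ℂ :=
  ∏ l ∈ Finset.range (a-k), ((1 - q^(k+l) * q^y * (q^N)⁻¹) * (1 - w * q^(N+2+k+l) * (q^y)⁻¹))

lemma Psi_eq (q w : ℂ) (hq : q ≠ 0) (n a k y : ℕ) :
    Psi q w (n+y) a k y = poch q ((q^n)⁻¹ * q^k) (a-k) * poch q (w * q^(n+2) * q^k) (a-k) := by
  rw [Psi, poch, poch, ← Finset.prod_mul_distrib]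
  refine Finset.prod_congr rfl fun l _ => ?_
  congr 2
  · field_simp
    ring
  · field_simp
    ring

noncomputable def Qsum (q c1 c2 c4 : ℂ) (N a x y : ℕ) : ℂ :=
  ∑ k ∈ Finset.range (a+1), poch q ((q^a)⁻¹) k * poch q (c2 * c1 * q ^ (a + 1)) k * q^k /
    (poch q (q*c2) k * poch q q k) * (poch q ((q ^ x)⁻¹) k * poch q (c4 * c2 * q ^ (x + 1)) k)
    * Psi q (c4*c2*c1) N a k y

lemma xsum (q c1 c2 c4 : ℂ) (a r x y : ℕ) (hq : q ≠ 0) (h1 : poch q q (a+r) ≠ 0)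
    (h2 : poch q (c4*c2*c1*q^(a+r+2)) a ≠ 0) :
    poch q q (a+r) / (poch q q a * poch q q r) * poch q (c4*c2*c1*q^(a+r+2)) a *
      SumN q c4 c2 c1 (a+r) a x = 
    (∏ l ∈ Finset.range a, (-(q^(r+1) * q^l))) / poch q q a * Qsum q c1 c2 c4 (a+r+y) a x y := by
  rw [SumN, Qsum, Finset.mul_sum, Finset.mul_sum]
  refine Finset.sum_congr rfl fun k hk => ?_
  have hk : k ≤ a := Nat.lt_succ_iff.1 (Finset.mem_range.1 hk)
  have R := poch_rev q (q^(r+1)) ((q^(a+r))⁻¹) a (by field_simp; ring) hq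
  have h3 : poch q ((q^(a+r))⁻¹) a ≠ 0 := poch_inv_ne hq (by omega) h1
  have e0 : poch q q (a+r) = poch q q r * poch q (q^(r+1)) a := by
    rw [add_comm, poch_add]; congr 2; ring
  rw [Psi_eq q _ hq, e0, R]
  have h4 : poch q q a ≠ 0 := poch_ne_of_le (by omega) h1
  have h5 : poch q q r ≠ 0 := poch_ne_of_le (by omega) h1
  have e1 : ∀ z : ℂ, poch q z a = poch q z k * poch q (z*q^k) (a-k) := by
    intro z
    rw [← poch_add]; congr 1; omega
  rw [e1 ((q^(a+r))⁻¹), e1 (c4*c2*c1*q^(a+r+2))]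
  rw [e1] at h2 h3
  have g2 := left_ne_zero_of_mul h2
  have g3 := left_ne_zero_of_mul h3
  have g1 : poch q q k ≠ 0 := poch_ne_of_le hk h4
  generalize (∏ l ∈ Finset.range a, (-(q^(r+1) * q^l))) = P
  generalize poch q ((q^(a+r))⁻¹) k = X1 at *
  generalize poch q ((q^(a+r))⁻¹ * q^k) (a-k) = X2 at *
  generalize poch q (c4*c2*c1*q^(a+r+2)) k = X3 at *
  generalize poch q (c4*c2*c1*q^(a+r+2)*q^k) (a-k) = X4 at *
  simp only [div_eq_mul_inv, mul_inv]
  have i1 := mul_inv_cancel₀ g2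
  have i2 := mul_inv_cancel₀ g3
  have i3 := mul_inv_cancel₀ h5
  generalize X1⁻¹ = Y1 at *
  generalize X3⁻¹ = Y3 at *
  generalize (poch q q r)⁻¹ = Y4 at *
  generalize (poch q q r) = X5 at *
  calc _ = (X3*Y3)*(X1*Y1)*(X5*Y4)*(P * (poch q q a)⁻¹ *
    (poch q (q ^ a)⁻¹ k * poch q (c2 * c1 * q ^ (a + 1)) k * q ^ k * ((poch q (q * c2) k)⁻¹ * (poch q q k)⁻¹) *
        (poch q (q ^ x)⁻¹ k * poch q (c4 * c2 * q ^ (x + 1)) k) *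
      (X2 * X4))) := by ring
   _ = _ := by rw [i1, i2, i3]; ring

/-- the `y`-independent constant -/
noncomputable def Kc (q s c0 c1 c2 c3 c4 t0 t2 : ℂ) (N a M j : ℕ) : ℂ :=
  OmN q s c3 c0 c4 t0 j (M-j) * ((1-c2*c1*q^(2*a+1)) * poch q (q*c2) a *
    poch q (q*c4) M * (s*t2)^N * (∏ l ∈ Finset.range a, (-(q^(M+1) * q^l)))
    / (poch q q a * poch q (q*c1) a * (s*t2)^(2*a) * poch q (c2*c1*q^(a+1)) (N+1)))

lemma term_eq (q s c0 c1 c2 c3 c4 t0 t2 τ : ℂ) (a r x y j : ℕ) (hj : j ≤ r + y) (hx : x ≤ a + r)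
    (hq : q ≠ 0) (hst : s*t2 ≠ 0) (hst0 : s*t0 ≠ 0) (hc0 : c0 ≠ 0) (hc1 : c1 ≠ 0) (hc2 : c2 ≠ 0)
    (hc3 : c3 ≠ 0) (hc4 : c4 ≠ 0)
    (hc : c0*c1*c2*c3*c4*q^(2*(a+r+y)+3) = 1) (hτ : c0*c1*c2*q^(a+r+y+2) = τ*(s*t2))
    (g1 : poch q q (a+r+y) ≠ 0) (g2 : poch q (q*c0) (a+r+y) ≠ 0) (g3 : poch q (q*c3) (a+r+y) ≠ 0)
    (g4 : poch q (q*c4) (a+r+y) ≠ 0) (g5 : poch q (c2*c1*q^(a+1)) (a+r+y+1) ≠ 0)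
    (g6 : poch q (c3*c0*c4*q^(r+y+2)) y ≠ 0) (g7 : poch q (c4*c2*c1*q^(a+r+2)) a ≠ 0) :
    p q s c4 c2 c1 t2 ((a + r : ℕ) : ℤ) (a : ℤ) (x : ℤ) *
      p q s c3 c0 c4 t0 ((r + y : ℕ) : ℤ) (j : ℤ) (y : ℤ) =
    Kc q s c0 c1 c2 c3 c4 t0 t2 (a+r+y) a (r+y) j * (poch q (q*c3) y / poch q (q*c0) y * τ^y) *
      (Qsum q c1 c2 c4 (a+r+y) a x y * Wsum q c0 c3 c4 (r+y) j y) := by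
  rw [p_nat q s c4 c2 c1 t2 hst a r x hx]
  have e : r + y = j + (r + y - j) := by omega
  have pj := p_nat q s c3 c0 c4 t0 hst0 j (r+y-j) y (by omega)
  rw [← e] at pj
  rw [pj]
  have h4y : poch q (q*c4*q^r) y ≠ 0 := by
    have : poch q (q*c4) (r+y) ≠ 0 := poch_ne_of_le (by omega) g4
    rw [poch_add] at this
    exact right_ne_zero_of_mul this
  have h6 : poch q ((c4*q^(r+y))⁻¹) y ≠ 0 :=
    poch_rev_ne (e := q*c4*q^r) (by field_simp; ring) hq h4y
  have Y : SumN q c3 c0 c4 (r+y) j y = _ := ysum q c0 c3 c4 (r+y) j y hj hq hc0 hc3 hc4 (poch_ne_of_le (by omega) g1) g6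
    (poch_ne_of_le (by omega) g2) (poch_inv_ne hq (by omega) (poch_ne_of_le (by omega) g1))
    (poch_ne_of_le (by omega) g3) h6
  have X := xsum q c1 c2 c4 a r x y hq (poch_ne_of_le (by omega) g1) g7
  rw [Y]
  have X' : OmN q s c4 c2 c1 t2 a r * SumN q c4 c2 c1 (a+r) a x =
      (1-c2*c1*q^(2*a+1))*poch q (q*c2) a *poch q (q*c4) r*(s*t2)^(a+r)
    /((s*t2)^(2*a)*poch q (c2*c1*q^(a+1)) (a+r+1)*poch q (q*c1) a) * ((∏ l ∈ Finset.range a, (-(q^(r+1) * q^l))) / poch q q a * Qsum q c1 c2 c4 (a+r+y) a x y) := by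
    rw [← X, OmN]
    simp only [div_eq_mul_inv]
    ring
  rw [X', Kc]
  have P : (∏ l ∈ Finset.range a, (-(q^(r+y+1) * q^l))) = (q^a)^y * (∏ l ∈ Finset.range a, (-(q^(r+1) * q^l))) := by
    rw [← pow_mul, mul_comm a y, pow_mul]
    nth_rw 2 [← Finset.card_range a]
    rw [← Finset.prod_const, ← Finset.prod_mul_distrib]
    exact Finset.prod_congr rfl fun l _ => by ring
  rw [P]
  have R := rev_ratio q (q*c4*q^r) ((c4*q^(r+y))⁻¹) (c2*c1*q^(a+1)*q^(a+r+1)) (c3*c0*c4*q^(r+y+2))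
    (c4/(c2*c1*q^(2*a+1))) y (by field_simp; ring)
    (by linear_combination q * hc) hq (by field_simp; ring)
  have e5 : a + r + y + 1 = (a+r+1) + y := by ring
  rw [e5, poch_add q _ (a+r+1) y] at g5 ⊢
  have f1 := left_ne_zero_of_mul g5
  have f2 := right_ne_zero_of_mul g5
  rw [poch_add q (q*c4) r y]
  have pw : (c0*c4*q^(r+y+1)) = (c4/(c2*c1*q^(2*a+1))) * (τ * (s*t2) * q^a) := by
    rw [← hτ]; field_simp; ring
  rw [pw, mul_pow, mul_pow, mul_pow, pow_add (s*t2) (a+r) y]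
  have hG : (c4/(c2*c1*q^(2*a+1)))^y ≠ 0 := by positivity
  generalize (c4/(c2*c1*q^(2*a+1)))^y = G at *
  generalize poch q (q*c4*q^r) y = X1 at *
  generalize poch q ((c4*q^(r+y))⁻¹) y = X2 at *
  generalize poch q (c2*c1*q^(a+1)*q^(a+r+1)) y = X3 at *
  generalize poch q (c3*c0*c4*q^(r+y+2)) y = X4 at *
  have key : G * X2 * X4⁻¹ = X1 * X3⁻¹ := by
    field_simp
    linear_combination -R
  simp only [div_eq_mul_inv, mul_inv]
  linear_combination (OmN q s c3 c0 c4 t0 j (r + y - j) * Qsum q c1 c2 c4 (a+r+y) a x y * 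
    Wsum q c0 c3 c4 (r+y) j y * poch q (q*c3) y * (poch q (q*c0) y)⁻¹ * τ^y * (s*t2)^y * (q^a)^y *
    (1-c2*c1*q^(2*a+1))*poch q (q*c2) a *poch q (q*c4) r*(s*t2)^(a+r)
    *((s*t2)^(2*a))⁻¹*(poch q (c2*c1*q^(a+1)) (a+r+1))⁻¹*(poch q (q*c1) a)⁻¹ * ((∏ l ∈ Finset.range a, (-(q^(r+1) * q^l))) * (poch q q a)⁻¹)) * key
end qR

namespace qR
open MvPolynomial

lemma Qsum_zero (q c1 c2 c4 : ℂ) (N a x y : ℕ) (hq : q ≠ 0) (hxy : x + y ≤ N) (ha : N < a + y) :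
    Qsum q c1 c2 c4 N a x y = 0 := by
  refine Finset.sum_eq_zero fun k hk => ?_
  by_cases hkx : x < k
  · rw [poch_inv_zero q hq x k hkx]; ring
  · have : Psi q (c4*c2*c1) N a k y = 0 := by
      rw [Psi, Finset.prod_eq_zero_iff]
      refine ⟨N - y - k, Finset.mem_range.2 (by omega), ?_⟩
      have : q^(k + (N-y-k)) * q^y * (q^N)⁻¹ = 1 := by
        rw [← pow_add, show k + (N-y-k) + y = N by omega, mul_inv_cancel₀ (pow_ne_zero _ hq)]
      rw [this]; ring
    rw [this]; ring

noncomputable def spec : MvPolynomial (Fin 2) ℂ →ₐ[ℂ] Polynomial ℂ := aeval ![Polynomial.X, 0]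

def IsDeg (P : MvPolynomial (Fin 2) ℂ) (D : ℕ) (κ : ℂ) : Prop :=
  P.totalDegree ≤ D ∧ (spec P).coeff D = κ

lemma spec_deg {P : MvPolynomial (Fin 2) ℂ} {D : ℕ} (h : P.totalDegree ≤ D) : (spec P).natDegree ≤ D := by
  have := MvPolynomial.aeval_natDegree_le (m := D) P h ![Polynomial.X, (0 : Polynomial ℂ)] (n := 1)
    (by intro i; fin_cases i <;> simp)
  simpa [spec] using this

lemma IsDeg.mul {P Q : MvPolynomial (Fin 2) ℂ} {D E : ℕ} {κ μ : ℂ} (h : IsDeg P D κ) (h' : IsDeg Q E μ) :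
    IsDeg (P*Q) (D+E) (κ*μ) := by
  refine ⟨(totalDegree_mul _ _).trans (add_le_add h.1 h'.1), ?_⟩
  rw [map_mul, Polynomial.coeff_mul_add_eq_of_natDegree_le (spec_deg h.1) (spec_deg h'.1), h.2, h'.2]

lemma IsDeg.mono {P : MvPolynomial (Fin 2) ℂ} {d D : ℕ} {κ : ℂ} (h : IsDeg P d κ) (hd : d < D) :
    IsDeg P D 0 :=
  ⟨h.1.trans hd.le, Polynomial.coeff_eq_zero_of_natDegree_lt ((spec_deg h.1).trans_lt hd)⟩

lemma IsDeg.sum {ι : Type*} (S : Finset ι) (f : ι → MvPolynomial (Fin 2) ℂ) (D : ℕ) (κ : ι → ℂ)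
    (h : ∀ i ∈ S, IsDeg (f i) D (κ i)) : IsDeg (∑ i ∈ S, f i) D (∑ i ∈ S, κ i) := by
  refine ⟨totalDegree_finsetSum_le fun i hi => (h i hi).1, ?_⟩
  rw [map_sum, Polynomial.finset_sum_coeff]
  exact Finset.sum_congr rfl fun i hi => (h i hi).2

lemma IsDeg.C (c : ℂ) : IsDeg (MvPolynomial.C c) 0 c := by
  refine ⟨by simp, ?_⟩
  simp [spec]

lemma IsDeg.Cmul {P : MvPolynomial (Fin 2) ℂ} {D : ℕ} {κ : ℂ} (c : ℂ) (h : IsDeg P D κ) :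
    IsDeg (MvPolynomial.C c * P) D (c * κ) := by
  have := (IsDeg.C c).mul h
  rwa [zero_add] at this

lemma IsDeg.prod (f : ℕ → MvPolynomial (Fin 2) ℂ) (κ : ℕ → ℂ) (h : ∀ l, IsDeg (f l) 1 (κ l)) (k : ℕ) :
    IsDeg (∏ l ∈ Finset.range k, f l) k (∏ l ∈ Finset.range k, κ l) := by
  induction k with
  | zero => simpa using IsDeg.C 1
  | succ k ih => rw [Finset.prod_range_succ, Finset.prod_range_succ]; exact ih.mul (h k)

/-- linear factor -/
noncomputable def lin (v : Fin 2) (α β γ : ℂ) : MvPolynomial (Fin 2) ℂ :=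
  MvPolynomial.C α - MvPolynomial.C β * (MvPolynomial.X v + MvPolynomial.C γ)

lemma lin_deg (v : Fin 2) (α β γ : ℂ) : (lin v α β γ).totalDegree ≤ 1 := by
  unfold lin
  refine (totalDegree_sub _ _).trans (max_le (by simp) ?_)
  refine (totalDegree_mul _ _).trans ?_
  have : (MvPolynomial.X v + MvPolynomial.C γ : MvPolynomial (Fin 2) ℂ).totalDegree ≤ 1 :=
    (totalDegree_add _ _).trans (max_le (by simp) (by simp))
  simpa using this

lemma lin_deg0 (α β γ : ℂ) : IsDeg (lin 0 α β γ) 1 (-β) := by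
  refine ⟨lin_deg _ _ _ _, ?_⟩
  simp [lin, spec, Polynomial.coeff_C, mul_add]

lemma lin_deg1 (α β γ : ℂ) : IsDeg (lin 1 α β γ) 1 0 := by
  refine ⟨lin_deg _ _ _ _, ?_⟩
  simp [lin, spec, Polynomial.coeff_C]

noncomputable def PhiPoly (q c : ℂ) (v : Fin 2) (k : ℕ) : MvPolynomial (Fin 2) ℂ :=
  ∏ l ∈ Finset.range k, lin v (1 + c*q^(2*l+1)) (q^l) (1 + c*q)

lemma lam_nat (q c : ℂ) (x : ℕ) : lam q c (x:ℤ) = -(1 - (q^x)⁻¹) * (1 - c * q^(x+1)) := by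
  rw [lam, zpow_neg, zpow_natCast, ← Nat.cast_succ, zpow_natCast]

lemma PhiPoly_eval (q c : ℂ) (hq : q ≠ 0) (v : Fin 2) (k x : ℕ) (z : Fin 2 → ℂ) (hz : z v = lam q c (x:ℤ)) :
    eval z (PhiPoly q c v k) = poch q ((q^x)⁻¹) k * poch q (c * q^(x+1)) k := by
  rw [PhiPoly, map_prod, poch, poch, ← Finset.prod_mul_distrib]
  refine Finset.prod_congr rfl fun l _ => ?_
  simp only [lin, map_sub, map_add, map_mul, eval_C, eval_X, hz, lam_nat]
  field_simp
  ring

noncomputable def PsiPoly (q w c : ℂ) (N a k : ℕ) : MvPolynomial (Fin 2) ℂ :=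
  ∏ l ∈ Finset.range (a-k), lin 1 (1 + q^(k+l)*(q^N)⁻¹ * (w*q^(N+2+k+l))) (w*q^(N+2+k+l)) (1 + c*q)

lemma PsiPoly_eval (q w c : ℂ) (hq : q ≠ 0) (N a k y : ℕ) (hw : c * w * q^(2*N+3) = 1) (z : Fin 2 → ℂ)
    (hz : z 1 = lam q c (y:ℤ)) :
    eval z (PsiPoly q w c N a k) = Psi q w N a k y := by
  rw [PsiPoly, map_prod, Psi]
  refine Finset.prod_congr rfl fun l _ => ?_
  simp only [lin, map_sub, map_add, map_mul, eval_C, eval_X, hz, lam_nat]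
  have e : q^(k+l)*(q^N)⁻¹ = w*q^(N+2+k+l) * c * q := by
    have : q^(k+l)*(q^N)⁻¹ = q^(k+l)*(q^N)⁻¹ * (c * w * q^(2*N+3)) := by rw [hw, mul_one]
    rw [this]; field_simp; ring
  have e2 : q^(k+l)*q^y*(q^N)⁻¹ = w*q^(N+2+k+l) * c * q * q^y := by rw [← e]; ring
  rw [e2, e]
  field_simp
  ring

noncomputable def Qpoly (q c0 c1 c2 c3 c4 : ℂ) (N a : ℕ) : MvPolynomial (Fin 2) ℂ :=
  ∑ k ∈ Finset.range (a+1), MvPolynomial.C (poch q ((q^a)⁻¹) k * poch q (c2 * c1 * q ^ (a + 1)) k * q^k /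
    (poch q (q*c2) k * poch q q k)) * (PhiPoly q (c4*c2) 0 k * PsiPoly q (c4*c2*c1) (c0*c3) N a k)

noncomputable def Wpoly (q c0 c3 c4 : ℂ) (M j : ℕ) : MvPolynomial (Fin 2) ℂ :=
  ∑ m ∈ Finset.range (M-j+1), MvPolynomial.C (poch q ((q^(M-j))⁻¹) m * poch q ((c0*c4*q^(M+j+1))⁻¹) m * q^m /
    (poch q ((q^M)⁻¹) m * poch q q m * poch q (q*c3) m * poch q ((c4*q^M)⁻¹) m)) *
    PhiPoly q (c0*c3) 1 m

lemma Qpoly_eval (q c0 c1 c2 c3 c4 : ℂ) (N a x y : ℕ) (hq : q ≠ 0)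
    (hc : c0*c1*c2*c3*c4*q^(2*N+3) = 1) :
    eval ![lam q (c4*c2) (x:ℤ), lam q (c0*c3) (y:ℤ)] (Qpoly q c0 c1 c2 c3 c4 N a) = Qsum q c1 c2 c4 N a x y := by
  rw [Qpoly, map_sum, Qsum]
  refine Finset.sum_congr rfl fun k _ => ?_
  rw [map_mul, map_mul, PhiPoly_eval q (c4*c2) hq 0 k x _ (by simp),
    PsiPoly_eval q _ _ hq N a k y (by rw [← hc]; ring) _ (by simp), eval_C]
  ring

lemma Wpoly_eval (q c0 c3 c4 : ℂ) (M j y : ℕ) (hq : q ≠ 0) (X : ℂ) :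
    eval ![X, lam q (c0*c3) (y:ℤ)] (Wpoly q c0 c3 c4 M j) = Wsum q c0 c3 c4 M j y := by
  rw [Wpoly, map_sum, Wsum]
  refine Finset.sum_congr rfl fun k _ => ?_
  rw [map_mul, PhiPoly_eval q (c0*c3) hq 1 k y _ (by simp), eval_C]

lemma Qpoly_deg (q c0 c1 c2 c3 c4 : ℂ) (N a : ℕ) (hq : q ≠ 0) 
    (h1 : poch q ((q^a)⁻¹) a ≠ 0) (h2 : poch q (c2 * c1 * q ^ (a + 1)) a ≠ 0) (h3 : poch q (q*c2) a ≠ 0)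
    (h4 : poch q q a ≠ 0) :
    ∃ κ, κ ≠ 0 ∧ IsDeg (Qpoly q c0 c1 c2 c3 c4 N a) a κ := by
  have hphi : ∀ k, IsDeg (PhiPoly q (c4*c2) 0 k) k (∏ l ∈ Finset.range k, (-(q^l))) := fun k =>
    IsDeg.prod _ (fun l => -(q^l)) (fun l => lin_deg0 _ _ _) k
  have hpsi : ∀ k, IsDeg (PsiPoly q (c4*c2*c1) (c0*c3) N a k) (a-k) (∏ l ∈ Finset.range (a-k), (0:ℂ)) := fun k =>
    IsDeg.prod _ (fun l => 0) (fun l => lin_deg1 _ _ _) (a-k)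
  let cf : ℕ → ℂ := fun k => poch q ((q^a)⁻¹) k * poch q (c2 * c1 * q ^ (a + 1)) k * q^k /
    (poch q (q*c2) k * poch q q k)
  have H := IsDeg.sum (Finset.range (a+1)) (fun k => MvPolynomial.C (cf k) * (PhiPoly q (c4*c2) 0 k * PsiPoly q (c4*c2*c1) (c0*c3) N a k)) a (fun k => cf k * ((∏ l ∈ Finset.range k, (-(q^l))) * (∏ l ∈ Finset.range (a-k), (0:ℂ))))
    (fun k hk => by
      have hk : k ≤ a := Nat.lt_succ_iff.1 (Finset.mem_range.1 hk)
      have := ((hphi k).mul (hpsi k)).Cmul (cf k)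
      rwa [show k + (a-k) = a by omega] at this)
  refine ⟨_, ?_, H⟩
  rw [Finset.sum_range_succ, Finset.sum_eq_zero]
  · simp only [Nat.sub_self, Finset.range_zero, Finset.prod_empty, zero_add, mul_one, cf]
    have : (∏ l ∈ Finset.range a, (-(q^l))) ≠ 0 :=
      Finset.prod_ne_zero_iff.2 fun l _ => neg_ne_zero.2 (pow_ne_zero _ hq)
    positivity
  · intro k hk
    have hk := Finset.mem_range.1 hk
    rw [Finset.prod_const, Finset.card_range, zero_pow (by omega)]
    ring

lemma Wpoly_deg (q c0 c3 c4 : ℂ) (M j : ℕ) (hjM : j ≤ M) :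
    ∃ κ, IsDeg (Wpoly q c0 c3 c4 M j) (M-j) κ ∧ (M = j → κ = 1) ∧ (j < M → κ = 0) := by
  have hphi : ∀ k, IsDeg (PhiPoly q (c0*c3) 1 k) k (∏ l ∈ Finset.range k, (0:ℂ)) := fun k =>
    IsDeg.prod _ (fun l => 0) (fun l => lin_deg1 _ _ _) k
  by_cases h : M = j
  · subst h
    refine ⟨1, ?_, fun _ => rfl, fun h => absurd h (lt_irrefl _)⟩
    simp [Wpoly, PhiPoly, poch_zero]
    simpa using IsDeg.C 1
  · refine ⟨0, ?_, fun h' => absurd h' h, fun _ => rfl⟩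
    have := IsDeg.sum (Finset.range (M-j+1)) (fun m => MvPolynomial.C (poch q ((q^(M-j))⁻¹) m * poch q ((c0*c4*q^(M+j+1))⁻¹) m * q^m /
    (poch q ((q^M)⁻¹) m * poch q q m * poch q (q*c3) m * poch q ((c4*q^M)⁻¹) m)) *
    PhiPoly q (c0*c3) 1 m) (M-j) (fun _ => 0) (fun m hm => by
      have hm : m ≤ M-j := Nat.lt_succ_iff.1 (Finset.mem_range.1 hm)
      have := (hphi m).Cmul (poch q ((q^(M-j))⁻¹) m * poch q ((c0*c4*q^(M+j+1))⁻¹) m * q^m /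
    (poch q ((q^M)⁻¹) m * poch q q m * poch q (q*c3) m * poch q ((c4*q^M)⁻¹) m))
      rcases hm.lt_or_eq with h1 | h1
      · exact this.mono h1
      · rw [Finset.prod_const, Finset.card_range, zero_pow (by omega), mul_zero] at this
        exact (fun D (hD : m = D) => by subst hD; exact this : ∀ D, m = D → IsDeg _ D 0) _ h1)
    rwa [Finset.sum_const_zero] at this
end qR

namespace qR

def Gen (q c : ℂ) (B : ℕ) : Prop := ∀ k : ℕ, 1 ≤ k → k ≤ B → c * q^k ≠ 1

lemma Gen.poch {q c : ℂ} {B : ℕ} (h : Gen q c B) (m n : ℕ) (hm : 1 ≤ m) (hn : m + n ≤ B + 1) :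
    poch q (c*q^m) n ≠ 0 := by
  refine poch_ne ?_
  intro l hl
  rw [mul_assoc, ← pow_add]
  exact h _ (by omega) (by omega)

lemma Gen.poch1 {q c : ℂ} {B : ℕ} (h : Gen q c B) (n : ℕ) (hn : n ≤ B) :
    qR.poch q (q*c) n ≠ 0 := by
  have := h.poch 1 n le_rfl (by omega)
  rwa [pow_one, mul_comm] at this

lemma Gen.one {q c : ℂ} {B : ℕ} (h : Gen q c B) (k : ℕ) (h1 : 1 ≤ k) (hn : k ≤ B) :
    1 - c*q^k ≠ 0 := fun h' => h k h1 hn (by linear_combination -h')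

lemma OmN_ne (q s c1 c2 c3 t2 : ℂ) (n r B : ℕ) (hst : s*t2 ≠ 0) (hB : 2*(n+r)+2 ≤ B)
    (g : poch q q (n+r) ≠ 0) (g1 : Gen q c1 B) (g2 : Gen q c2 B) (g3 : Gen q c3 B)
    (g23 : Gen q (c2*c3) B) (g123 : Gen q (c1*c2*c3) B) : OmN q s c1 c2 c3 t2 n r ≠ 0 := by
  have a1 := poch_ne_of_le (show n ≤ n+r by omega) g
  have a2 := poch_ne_of_le (show r ≤ n+r by omega) g
  have a3 := g23.one (2*n+1) (by omega) (by omega)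
  have a4 := g2.poch1 n (by omega)
  have a5 := g123.poch (n+r+2) n (by omega) (by omega)
  have a6 := g1.poch1 r (by omega)
  have a7 := g23.poch (n+1) (n+r+1) (by omega) (by omega)
  have a8 := g3.poch1 n (by omega)
  unfold OmN
  refine div_ne_zero ?_ ?_
  · refine mul_ne_zero (mul_ne_zero (mul_ne_zero (mul_ne_zero (mul_ne_zero (div_ne_zero g (mul_ne_zero a1 a2)) a3) a4) a5) a6) (pow_ne_zero _ hst)
  · exact mul_ne_zero (mul_ne_zero (pow_ne_zero _ hst) a7) a8

lemma p_top_ne (q s c1 c2 c3 t2 : ℂ) (n r B : ℕ) (hq : q ≠ 0) (hst : s*t2 ≠ 0) (hB : 2*(n+r)+2 ≤ B)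
    (hc1 : c1 ≠ 0) (hc2 : c2 ≠ 0) (hc3 : c3 ≠ 0)
    (g : poch q q (n+r) ≠ 0) (g1 : Gen q c1 B) (g2 : Gen q c2 B) (g3 : Gen q c3 B)
    (g23 : Gen q (c2*c3) B) (g123 : Gen q (c1*c2*c3) B) :
    p q s c1 c2 c3 t2 ((n+r:ℕ):ℤ) n ((n+r:ℕ):ℤ) ≠ 0 := by
  rw [p_nat q s c1 c2 c3 t2 hst n r (n+r) le_rfl]
  refine mul_ne_zero (OmN_ne q s c1 c2 c3 t2 n r B hst hB g g1 g2 g3 g23 g123) ?_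
  set d := (c1*c2*c3*q^(n+(n+r)+1))⁻¹ with hd
  have hX : c1*c2*c3*q^(n+(n+r)+1) ≠ 0 := by simp [hc1, hc2, hc3, hq]
  have hdX : d*(c1*c2*c3*q^(n+(n+r)+1)) = 1 := inv_mul_cancel₀ hX
  have hd0 : d ≠ 0 := inv_ne_zero hX
  have habd : c2*c3*q^(n+1) * (c1*c2*q^(n+r+1)) * d = q*c2 := by
    linear_combination (q*c2)*hdX
  have hbd : (c1*c2*q^(n+r+1)*d) * (c3*q^n) = 1 := by
    linear_combination hdX
  have had : (c2*c3*q^(n+1)*d) * (c1*q^(n+r)) = 1 := by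
    linear_combination hdX
  have a1 := poch_ne_of_le (show n ≤ n+r by omega) g
  have hF : c1*c2*c3*q^(n+r+2)*d*q^n = q := by
    linear_combination q*hdX
  have e2 : poch q d n ≠ 0 := by
    refine poch_rev_ne hF hq |> fun h => ?_
    exact h (g123.poch (n+r+2) n (by omega) (by omega))
  have := saal3 q (c2*c3*q^(n+1)) (c1*c2*q^(n+r+1)) d ((q^n)⁻¹) (c1*c2*c3*q^(n+r+2)) n
    (inv_mul_cancel₀ (pow_ne_zero _ hq)) (by linear_combination hF) hq a1 e2
    (by rw [habd]; exact g2.poch1 n (by omega))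
  have hS : SumN q c1 c2 c3 (n+r) n (n+r) = 
      poch q (c1*c2*q^(n+r+1)*d) n * poch q (c2*c3*q^(n+1)*d) n / (poch q (q*c2) n * poch q d n) := by
    rw [habd] at this
    rw [← this, SumN]
    refine Finset.sum_congr rfl fun k hk => ?_
    have hk : k ≤ n := Nat.lt_succ_iff.1 (Finset.mem_range.1 hk)
    have b := poch_inv_ne hq (show k ≤ n+r by omega) g
    have b1 := poch_ne_of_le hk (g2.poch1 n (by omega))
    have b2 := poch_ne_of_le hk (g123.poch (n+r+2) n (by omega) (by omega))
    have b3 := poch_ne_of_le hk a1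
    rw [div_eq_div_iff (mul_ne_zero (mul_ne_zero (mul_ne_zero b1 b2) b) b3) (mul_ne_zero (mul_ne_zero b1 b2) b3)]
    ring
  rw [hS]
  refine div_ne_zero (mul_ne_zero ?_ ?_) (mul_ne_zero (g2.poch1 n (by omega)) e2)
  · have : (c3*q^1) * (c1*c2*q^(n+r+1)*d) * q^n = q := by linear_combination q*hbd
    exact poch_rev_ne this hq (g3.poch 1 n le_rfl (by omega))
  · have : (c1*q^(r+1)) * (c2*c3*q^(n+1)*d) * q^n = q := by linear_combination q*had
    exact poch_rev_ne this hq (g1.poch (r+1) n (by omega) (by omega))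

lemma Kc_ne (q s c0 c1 c2 c3 c4 t0 t2 : ℂ) (a j B : ℕ) (hq : q ≠ 0) (hst : s*t2 ≠ 0) (hst0 : s*t0 ≠ 0)
    (hB : 2*(a+j)+2 ≤ B) (g : poch q q (a+j) ≠ 0)
    (g0 : Gen q c0 B) (g1 : Gen q c1 B) (g2 : Gen q c2 B) (g3 : Gen q c3 B) (g4 : Gen q c4 B)
    (g21 : Gen q (c2*c1) B) (g04 : Gen q (c0*c4) B) (g304 : Gen q (c3*c0*c4) B) :
    Kc q s c0 c1 c2 c3 c4 t0 t2 (a+j) a j j ≠ 0 := by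
  unfold Kc
  rw [Nat.sub_self]
  have a1 := poch_ne_of_le (show a ≤ a+j by omega) g
  have a2 := poch_ne_of_le (show j ≤ a+j by omega) g
  refine mul_ne_zero (OmN_ne q s c3 c0 c4 t0 j 0 B hst0 (by omega) a2 g3 g0 g4 g04 g304) (div_ne_zero ?_ ?_)
  · refine mul_ne_zero (mul_ne_zero (mul_ne_zero (mul_ne_zero (g21.one _ (by omega) (by omega))
      (g2.poch1 _ (by omega))) (g4.poch1 _ (by omega))) (pow_ne_zero _ hst)) ?_
    rw [Finset.prod_ne_zero_iff]
    intro l _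
    exact neg_ne_zero.2 (mul_ne_zero (pow_ne_zero _ hq) (pow_ne_zero _ hq))
  · exact mul_ne_zero (mul_ne_zero (mul_ne_zero a1 (g1.poch1 _ (by omega))) (pow_ne_zero _ hst))
      (g21.poch _ _ (by omega) (by omega))

end qR

/-- Polynomiality of the Griffiths polynomials of q-Racah type. -/
theorem griffiths_polynomiality
    (N : ℕ) (q s c1 c2 c3 c4 c0 t1 t2 t3 t4 t0 : ℂ)
    (hq : q ≠ 0) (hc1 : c1 ≠ 0) (hc2 : c2 ≠ 0) (hc3 : c3 ≠ 0) (hc4 : c4 ≠ 0)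
    (hs : s ^ 2 = q) (ht1 : t1 ^ 2 = c1) (ht2 : t2 ^ 2 = c2) (ht3 : t3 ^ 2 = c3)
    (ht4 : t4 ^ 2 = c4)
    (hc0 : c0 = (q ^ (2 * (N : ℤ) + 3) * c1 * c2 * c3 * c4)⁻¹)
    (ht0 : t0 = (s ^ (2 * (N : ℤ) + 3) * t1 * t2 * t3 * t4)⁻¹)
    (hgen : ∀ e0 e1 e2 e3 e4 : ℕ, e0 ≤ 1 → e1 ≤ 1 → e2 ≤ 1 → e3 ≤ 1 → e4 ≤ 1 →
      1 ≤ e0 + e1 + e2 + e3 + e4 → e0 + e1 + e2 + e3 + e4 ≤ 4 →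
      ∀ k : ℤ, 1 ≤ k → k ≤ 2 * (N : ℤ) + 5 →
        c0 ^ e0 * c1 ^ e1 * c2 ^ e2 * c3 ^ e3 * c4 ^ e4 ≠ q ^ (-k))
    (hq1 : ∀ k : ℕ, 1 ≤ k → k ≤ N → q ^ k ≠ 1)
    (i j : ℕ) (hij : i + j ≤ N) :
    ∃ P : MvPolynomial (Fin 2) ℂ, P.totalDegree = N - j ∧
      ∀ x y : ℕ, x + y ≤ N →
        ((-1 : ℂ) ^ N * (t3 / t1) ^ N * (t1 / t4) ^ y
              * qR.xi q c0 (c0 * c4 * q ^ N) t0 (t0 * t4 * s ^ N) (N : ℤ)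
              * qR.xi q c3 c0 t3 t0 (y : ℤ) ≠ 0)
          ∧
        qR.G q s c1 c2 c3 c4 t1 t2 t3 t4 (N : ℤ) (i : ℤ) (j : ℤ) (x : ℤ) (y : ℤ)
          = (-1 : ℂ) ^ N * (t3 / t1) ^ N * (t1 / t4) ^ y
              * qR.xi q c0 (c0 * c4 * q ^ N) t0 (t0 * t4 * s ^ N) (N : ℤ)
              * qR.xi q c3 c0 t3 t0 (y : ℤ)
              * MvPolynomial.eval ![qR.lam q (c4 * c2) (x : ℤ), qR.lam q (c0 * c3) (y : ℤ)] P := by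
  have hs0 : s ≠ 0 := by rintro rfl; apply hq; rw [← hs]; norm_num
  have h10 : t1 ≠ 0 := by rintro rfl; apply hc1; rw [← ht1]; norm_num
  have h20 : t2 ≠ 0 := by rintro rfl; apply hc2; rw [← ht2]; norm_num
  have h30 : t3 ≠ 0 := by rintro rfl; apply hc3; rw [← ht3]; norm_num
  have h40 : t4 ≠ 0 := by rintro rfl; apply hc4; rw [← ht4]; norm_num
  have hX : q ^ (2 * (N : ℤ) + 3) * c1 * c2 * c3 * c4 ≠ 0 :=
    mul_ne_zero (mul_ne_zero (mul_ne_zero (mul_ne_zero (zpow_ne_zero _ hq) hc1) hc2) hc3) hc4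
  have hY : s ^ (2 * (N : ℤ) + 3) * t1 * t2 * t3 * t4 ≠ 0 :=
    mul_ne_zero (mul_ne_zero (mul_ne_zero (mul_ne_zero (zpow_ne_zero _ hs0) h10) h20) h30) h40
  have hc00 : c0 ≠ 0 := by rw [hc0]; exact inv_ne_zero hX
  have h00 : t0 ≠ 0 := by rw [ht0]; exact inv_ne_zero hY
  have eqz : ∀ z : ℂ, z ^ (2 * (N : ℤ) + 3) = z ^ (2*N+3) := fun z => by
    rw [← zpow_natCast]; congr 1
  have hc : c0*c1*c2*c3*c4*q^(2*N+3) = 1 := by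
    have : c0 * (q ^ (2 * (N : ℤ) + 3) * c1 * c2 * c3 * c4) = 1 := by
      rw [hc0]; exact inv_mul_cancel₀ hX
    rw [eqz] at this
    linear_combination this
  have ht : t0*t1*t2*t3*t4*s^(2*N+3) = 1 := by
    have : t0 * (s ^ (2 * (N : ℤ) + 3) * t1 * t2 * t3 * t4) = 1 := by
      rw [ht0]; exact inv_mul_cancel₀ hY
    rw [eqz] at this
    linear_combination this
  have ht02 : t0^2 = c0 := by
    have h2 : t0^2*(c1*c2*c3*c4*q^(2*N+3)) = 1 := by
      rw [← ht1, ← ht2, ← ht3, ← ht4, ← hs, ← pow_mul, mul_comm 2 (2*N+3), pow_mul s]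
      linear_combination (t0*t1*t2*t3*t4*s^(2*N+3) + 1) * ht
    have hne : c1*c2*c3*c4*q^(2*N+3) ≠ 0 := by simp [hc1, hc2, hc3, hc4, hq]
    apply mul_right_cancel₀ hne
    rw [h2]; linear_combination -hc
  have hst : s*t2 ≠ 0 := mul_ne_zero hs0 h20
  have hst0 : s*t0 ≠ 0 := mul_ne_zero hs0 h00
  obtain ⟨τ, hτd⟩ : ∃ τ, τ = t0*t1/(t3*t4) := ⟨_, rfl⟩
  have hτ0 : τ ≠ 0 := by rw [hτd]; exact div_ne_zero (mul_ne_zero h00 h10) (mul_ne_zero h30 h40)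
  have hτ : c0*c1*c2*q^(N+2) = τ*(s*t2) := by
    have e1 : c0*c1*c2*q^(N+2) * (t3*t4) = t0*t1*(s*t2) := by
      rw [← ht02, ← ht1, ← ht2, ← hs, ← pow_mul, show 2*(N+2) = 2*N+3+1 by ring, pow_succ]
      linear_combination (t0*t1*t2*s)*ht
    rw [hτd, div_mul_eq_mul_div, eq_div_iff (mul_ne_zero h30 h40), e1]
  -- genericity
  have gen : ∀ e0 e1 e2 e3 e4 : ℕ, e0 ≤ 1 → e1 ≤ 1 → e2 ≤ 1 → e3 ≤ 1 → e4 ≤ 1 →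
      1 ≤ e0 + e1 + e2 + e3 + e4 → e0 + e1 + e2 + e3 + e4 ≤ 4 →
      qR.Gen q (c0 ^ e0 * c1 ^ e1 * c2 ^ e2 * c3 ^ e3 * c4 ^ e4) (2*N+5) := by
    intro e0 e1 e2 e3 e4 a0 a1 a2 a3 a4 b1 b2 k hk1 hk2 h
    apply hgen e0 e1 e2 e3 e4 a0 a1 a2 a3 a4 b1 b2 (k:ℤ) (by omega) (by omega)
    rw [zpow_neg, zpow_natCast]
    exact eq_inv_of_mul_eq_one_left h
  have g0 : qR.Gen q c0 (2*N+5) := by simpa using gen 1 0 0 0 0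
  have g1 : qR.Gen q c1 (2*N+5) := by simpa using gen 0 1 0 0 0
  have g2 : qR.Gen q c2 (2*N+5) := by simpa using gen 0 0 1 0 0
  have g3 : qR.Gen q c3 (2*N+5) := by simpa using gen 0 0 0 1 0
  have g4 : qR.Gen q c4 (2*N+5) := by simpa using gen 0 0 0 0 1
  have g21 : qR.Gen q (c2*c1) (2*N+5) := by
    rw [mul_comm]; simpa using gen 0 1 1 0 0
  have g23 : qR.Gen q (c2*c3) (2*N+5) := by simpa using gen 0 0 1 1 0
  have g04 : qR.Gen q (c0*c4) (2*N+5) := by simpa using gen 1 0 0 0 1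
  have g304 : qR.Gen q (c3*c0*c4) (2*N+5) := by
    rw [mul_comm c3]; simpa using gen 1 0 0 1 1
  have g123 : qR.Gen q (c1*c2*c3) (2*N+5) := by simpa using gen 0 1 1 1 0
  have g421 : qR.Gen q (c4*c2*c1) (2*N+5) := by
    rw [show c4*c2*c1 = c1*c2*c4 by ring]; simpa using gen 0 1 1 0 1
  have gq : qR.poch q q N ≠ 0 := by
    refine qR.poch_ne fun l hl => ?_
    rw [← pow_succ']
    exact hq1 _ (by omega) (by omega)
  -- prefactor
  obtain ⟨K, hK⟩ : ∃ K, K = (-1 : ℂ) ^ N * (t3 / t1) ^ N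
              * qR.xi q c0 (c0 * c4 * q ^ N) t0 (t0 * t4 * s ^ N) (N : ℤ) := ⟨_, rfl⟩
  have hK0 : K ≠ 0 := by
    rw [hK, qR.xi]
    have b1 := g0.poch1 N (by omega)
    have b2 := g04.poch (N+1) N (by omega) (by omega)
    rw [show c0*c4*q^(N+1) = q*(c0*c4*q^N) by ring] at b2
    rw [Int.toNat_natCast]
    exact mul_ne_zero (mul_ne_zero (pow_ne_zero _ (by norm_num)) (pow_ne_zero _ (div_ne_zero h30 h10)))
      (mul_ne_zero (div_ne_zero b1 b2) (zpow_ne_zero _ (div_ne_zero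
        (mul_ne_zero (mul_ne_zero h00 h40) (pow_ne_zero _ hs0)) h00)))
  have hpref : ∀ y : ℕ, (-1 : ℂ) ^ N * (t3 / t1) ^ N * (t1 / t4) ^ y
              * qR.xi q c0 (c0 * c4 * q ^ N) t0 (t0 * t4 * s ^ N) (N : ℤ)
              * qR.xi q c3 c0 t3 t0 (y : ℤ)
      = K * (qR.poch q (q*c3) y / qR.poch q (q*c0) y * τ^y) := by
    intro y
    have : τ^y = (t1/t4)^y * (t0/t3)^y := by
      rw [hτd, ← mul_pow]; congr 1; field_simp
    rw [hK, this, qR.xi.eq_1 q c3, Int.toNat_natCast, zpow_natCast]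
    ring
  obtain ⟨u, hu⟩ : ∃ u : ℕ → ℂ, u = fun a : ℕ => qR.om q (t1 * t2 * t3 / t4) (a : ℤ) *
    qR.p q s c1 c2 c3 t2 ((N:ℤ) - j) i (a : ℤ) * qR.Kc q s c0 c1 c2 c3 c4 t0 t2 N a (N-a) j := ⟨_, rfl⟩
  refine ⟨∑ a ∈ Finset.range (N-j+1), MvPolynomial.C (u a / K) *
    (qR.Qpoly q c0 c1 c2 c3 c4 N a * qR.Wpoly q c0 c3 c4 (N-a) j), ?_, ?_⟩
  · -- degree
    have key : ∀ a ∈ Finset.range (N-j+1), ∃ κ, qR.IsDeg (MvPolynomial.C (u a / K) *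
        (qR.Qpoly q c0 c1 c2 c3 c4 N a * qR.Wpoly q c0 c3 c4 (N-a) j)) (N-j) κ ∧
        (a < N-j → κ = 0) ∧ (a = N-j → κ ≠ 0) := by
      intro a ha
      have ha : a ≤ N-j := Nat.lt_succ_iff.1 (Finset.mem_range.1 ha)
      obtain ⟨κ, hκ, hQ⟩ := qR.Qpoly_deg q c0 c1 c2 c3 c4 N a hq
        (qR.poch_inv_ne hq le_rfl (qR.poch_ne_of_le (by omega) gq))
        (g21.poch _ _ (by omega) (by omega)) (g2.poch1 _ (by omega))
        (qR.poch_ne_of_le (by omega) gq)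
      obtain ⟨μ, hW, hW1, hW2⟩ := qR.Wpoly_deg q c0 c3 c4 (N-a) j (by omega)
      have h := (hQ.mul hW).Cmul (u a / K)
      rw [show a + (N-a-j) = N-j by omega] at h
      refine ⟨_, h, fun hlt => ?_, fun heq => ?_⟩
      · rw [hW2 (by omega)]; ring
      · rw [hW1 (by omega), mul_one]
        refine mul_ne_zero (div_ne_zero ?_ hK0) hκ
        rw [hu]
        refine mul_ne_zero (mul_ne_zero ?_ ?_) ?_
        · exact mul_ne_zero (mul_ne_zero (zpow_ne_zero _ (by norm_num)) (zpow_ne_zero _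
            (div_ne_zero (mul_ne_zero (mul_ne_zero h10 h20) h30) h40))) (zpow_ne_zero _ hq)
        · have := qR.p_top_ne q s c1 c2 c3 t2 i (N-j-i) (2*N+5) hq hst (by omega) hc1 hc2 hc3
            (qR.poch_ne_of_le (by omega) gq) g1 g2 g3 g23 g123
          rw [show i + (N-j-i) = a by omega] at this
          rwa [show (N:ℤ) - j = (a:ℤ) by omega]
        · have := qR.Kc_ne q s c0 c1 c2 c3 c4 t0 t2 a j (2*N+5) hq hst hst0 (by omega)
            (qR.poch_ne_of_le (by omega) gq) g0 g1 g2 g3 g4 g21 g04 g304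
          rw [show a + j = N by omega] at this
          rwa [show N - a = j by omega]
    choose! κ hκ using key
    have hsum := qR.IsDeg.sum _ _ _ κ fun a ha => (hκ a ha).1
    refine le_antisymm hsum.1 ?_
    by_contra hlt
    push Not at hlt
    have hz := Polynomial.coeff_eq_zero_of_natDegree_lt ((qR.spec_deg le_rfl).trans_lt hlt)
    rw [hsum.2, Finset.sum_range_succ, Finset.sum_eq_zero, zero_add] at hz
    · exact (hκ (N-j) (Finset.mem_range.2 (by omega))).2.2 rfl hz
    · intro a ha
      have := Finset.mem_range.1 ha
      exact (hκ a (Finset.mem_range.2 (by omega))).2.1 this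
  · intro x y hxy
    rw [hpref]
    have hb0 := g0.poch1 y (by omega)
    have hb3 := g3.poch1 y (by omega)
    refine ⟨mul_ne_zero hK0 (mul_ne_zero (div_ne_zero hb3 hb0) (pow_ne_zero _ hτ0)), ?_⟩
    rw [qR.G, if_pos ⟨by omega, by omega, by omega⟩, ← hc0, ← ht0, map_sum, Finset.mul_sum]
    have hmin : (min ((N:ℤ) - j) ((N:ℤ) - y)).toNat + 1 ≤ N-j+1 := by omega
    rw [← Finset.sum_subset (Finset.range_subset_range.2 hmin)]
    · refine Finset.sum_congr rfl fun a ha => ?_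
      have ha := Finset.mem_range.1 ha
      have ha1 : a ≤ N-j := by omega
      have ha2 : a + y ≤ N := by omega
      obtain ⟨r, hr⟩ : ∃ r, N = a + r + y := ⟨N-y-a, by omega⟩
      have hT := qR.term_eq q s c0 c1 c2 c3 c4 t0 t2 τ a r x y j (by omega) (by omega) hq hst hst0
        hc00 hc1 hc2 hc3 hc4 (by rw [← hr]; exact hc) (by rw [← hr]; exact hτ) (by rw [← hr]; exact gq)
        (g0.poch1 _ (by omega)) (g3.poch1 _ (by omega)) (g4.poch1 _ (by omega))
        (g21.poch _ _ (by omega) (by omega)) (g304.poch _ _ (by omega) (by omega))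
        (g421.poch _ _ (by omega) (by omega))
      rw [← hr, show r + y = N - a by omega, show a + r = N - y by omega,
        Nat.cast_sub (show a ≤ N by omega), Nat.cast_sub (show y ≤ N by omega)] at hT
      rw [map_mul, map_mul, MvPolynomial.eval_C, qR.Qpoly_eval q c0 c1 c2 c3 c4 N a x y hq hc,
        qR.Wpoly_eval _ _ _ _ _ _ _ hq, mul_assoc, mul_comm (qR.p q s c3 c0 c4 t0 _ _ _), hT, hu]
      field_simp
    · intro a ha hna
      have ha := Finset.mem_range.1 ha
      have hna : ¬ (a < (min ((N:ℤ) - j) ((N:ℤ) - y)).toNat + 1) := fun h => hna (Finset.mem_range.2 h)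
      rw [map_mul, map_mul, qR.Qpoly_eval q c0 c1 c2 c3 c4 N a x y hq hc,
        qR.Qsum_zero q c1 c2 c4 N a x y hq hxy (by omega)]
      ring
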